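/- arXiv:1304.0375 — 2 statements merged into one kernel-verified Lean document; each statement's English description precedes it below -/
import Mathlib

section
/- Let Y be a countable complete metric space, (T, 𝒯, λ) an atomless probability space, and F : T → Set Y a measurable correspondence with nonempty compact values. Then the set D_F = {λ ∘ f⁻¹ : f a measurable selection of F} is compact in the space M(Y) of Borel probability measures on Y endowed with the topology of weak convergence. -/
open MeasureTheory

/-- A measure is atomless: every measurable set of positive measure has a measurable
subset of strictly smaller positive measure. -/
def AtomlessMeasure {T : Type*} [MeasurableSpace T] (μ : Measure T) : Prop :=
  ∀ A : Set T, MeasurableSet A → 0 < μ A →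
    ∃ B : Set T, B ⊆ A ∧ MeasurableSet B ∧ 0 < μ B ∧ μ B < μ A

open Set Filter Topology
open scoped ENNReal

namespace AtomlessMeasure

variable {T : Type*} [MeasurableSpace T] {μ : Measure T}

lemma exists_subset_le_half [IsFiniteMeasure μ] (h : AtomlessMeasure μ) {A : Set T}
    (hA : MeasurableSet A) (hpos : 0 < μ A) :
    ∃ B ⊆ A, MeasurableSet B ∧ 0 < μ B ∧ μ B ≤ μ A / 2 := by
  obtain ⟨B, hBA, hB, hB0, hlt⟩ := h A hA hpos
  have hsum : μ B + μ (A \ B) = μ A := by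
    rw [← measure_inter_add_sdiff A hB, inter_eq_self_of_subset_right hBA]
  rcases le_total (μ B) (μ (A \ B)) with hle | hle
  · refine ⟨B, hBA, hB, hB0, ?_⟩
    rw [ENNReal.le_div_iff_mul_le (by simp) (by simp), mul_two, ← hsum]
    gcongr
  · refine ⟨A \ B, sdiff_subset, hA.diff hB, ?_, ?_⟩
    · rw [pos_iff_ne_zero]
      intro h0
      rw [h0, add_zero] at hsum
      exact hlt.ne hsum
    · rw [ENNReal.le_div_iff_mul_le (by simp) (by simp), mul_two, ← hsum]
      gcongr

lemma exists_subset_lt [IsFiniteMeasure μ] (h : AtomlessMeasure μ) {A : Set T}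
    (hA : MeasurableSet A) (hpos : 0 < μ A) {ε : ℝ≥0∞} (hε : 0 < ε) :
    ∃ B ⊆ A, MeasurableSet B ∧ 0 < μ B ∧ μ B < ε := by
  have hstep : ∀ n : ℕ, ∃ B ⊆ A, MeasurableSet B ∧ 0 < μ B ∧ μ B ≤ μ A * 2⁻¹ ^ n := by
    intro n
    induction n with
    | zero => exact ⟨A, subset_rfl, hA, hpos, by simp⟩
    | succ n ih =>
      obtain ⟨B, hBA, hB, hB0, hle⟩ := ih
      obtain ⟨C, hCB, hC, hC0, hCle⟩ := h.exists_subset_le_half hB hB0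
      refine ⟨C, hCB.trans hBA, hC, hC0, hCle.trans ?_⟩
      rw [pow_succ, ← mul_assoc, ← div_eq_mul_inv]
      gcongr
  have hlim : Tendsto (fun n : ℕ => μ A * 2⁻¹ ^ n) atTop (𝓝 0) := by
    simpa using ENNReal.Tendsto.const_mul
      (ENNReal.tendsto_pow_atTop_nhds_zero_of_lt_one (r := 2⁻¹) (by simp))
      (Or.inr (measure_ne_top μ A))
  obtain ⟨n, hn⟩ := (hlim.eventually_lt_const hε).exists
  obtain ⟨B, hBA, hB, hB0, hle⟩ := hstep n
  exact ⟨B, hBA, hB, hB0, hle.trans_lt hn⟩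

/-- **Sierpiński's theorem**: a finite atomless measure takes all intermediate values. -/
lemma exists_subset_measure_eq [IsFiniteMeasure μ] (h : AtomlessMeasure μ) {S : Set T}
    (hS : MeasurableSet S) {c : ℝ≥0∞} (hc : c ≤ μ S) :
    ∃ A ⊆ S, MeasurableSet A ∧ μ A = c := by
  have hctop : c ≠ ∞ := ne_top_of_le_ne_top (measure_ne_top μ S) hc
  let P : Set T → Prop := fun A => A ⊆ S ∧ MeasurableSet A ∧ μ A ≤ c
  have hstep : ∀ (n : ℕ) (A : {A // P A}), ∃ A' : {A // P A}, A.1 ⊆ A'.1 ∧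
      ∀ B : {A // P A}, A.1 ⊆ B.1 → μ B.1 ≤ μ A'.1 + (n + 1 : ℝ≥0∞)⁻¹ := by
    intro n A
    by_contra! hcon
    let I := {B : {A // P A} // A.1 ⊆ B.1}
    have hI : Nonempty I := ⟨⟨A, subset_rfl⟩⟩
    have hsup : (⨆ B : I, μ B.1.1) + (n + 1 : ℝ≥0∞)⁻¹ ≤ ⨆ B : I, μ B.1.1 := by
      rw [ENNReal.iSup_add]
      refine iSup_le fun A' => ?_
      obtain ⟨B, hAB, hB⟩ := hcon A'.1 A'.2
      exact hB.le.trans (le_iSup (fun B : I => μ B.1.1) ⟨B, hAB⟩)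
    have hfin : (⨆ B : I, μ B.1.1) ≠ ∞ :=
      ne_top_of_le_ne_top hctop (iSup_le fun B => B.1.2.2.2)
    refine absurd hsup (not_le.2 (ENNReal.lt_add_right hfin ?_))
    simp
  choose next hsub hmax using hstep
  let A : ℕ → {A // P A} := fun n => Nat.rec ⟨∅, empty_subset _, .empty, by simp⟩ next n
  have hmono : Monotone fun n => (A n).1 := monotone_nat_of_le_succ fun n => hsub n (A n)
  have hU : P (⋃ n, (A n).1) := by
    refine ⟨iUnion_subset fun n => (A n).2.1, .iUnion fun n => (A n).2.2.1, ?_⟩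
    rw [hmono.measure_iUnion]
    exact iSup_le fun n => (A n).2.2.2
  refine ⟨⋃ n, (A n).1, hU.1, hU.2.1, hU.2.2.antisymm ?_⟩
  by_contra! hlt
  have hdiff : 0 < μ (S \ ⋃ n, (A n).1) := by
    rw [measure_sdiff hU.1 hU.2.1.nullMeasurableSet (measure_ne_top _ _)]
    exact tsub_pos_of_lt (hlt.trans_le hc)
  obtain ⟨B, hBS, hB, hB0, hBlt⟩ := h.exists_subset_lt (hS.diff hU.2.1) hdiff (tsub_pos_of_lt hlt)
  have hdisj : μ ((⋃ n, (A n).1) ∪ B) = μ (⋃ n, (A n).1) + μ B :=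
    measure_union (disjoint_sdiff_right.mono_right hBS) hB
  have hP : P ((⋃ n, (A n).1) ∪ B) := by
    refine ⟨union_subset hU.1 (hBS.trans sdiff_subset), hU.2.1.union hB, ?_⟩
    rw [hdisj]
    calc _ ≤ μ (⋃ n, (A n).1) + (c - μ (⋃ n, (A n).1)) := by gcongr
      _ = c := add_tsub_cancel_of_le hlt.le
  have hle : ∀ n : ℕ, μ (⋃ n, (A n).1) + μ B ≤ μ (⋃ n, (A n).1) + (n + 1 : ℝ≥0∞)⁻¹ := by
    intro n
    rw [← hdisj]
    refine (hmax n (A n) ⟨_, hP⟩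
      ((subset_iUnion (fun n => (A n).1) n).trans subset_union_left)).trans ?_
    gcongr
    exact subset_iUnion (fun n => (A n).1) (n + 1)
  have hzero : μ B ≤ 0 := by
    have hlim : Tendsto (fun n : ℕ => (n + 1 : ℝ≥0∞)⁻¹) atTop (𝓝 0) := by
      simpa using (tendsto_add_atTop_iff_nat 1).2 ENNReal.tendsto_inv_nat_nhds_zero
    exact ge_of_tendsto' hlim fun n =>
      (ENNReal.add_le_add_iff_left (measure_ne_top _ _)).1 (hle n)
  exact hB0.not_ge hzero

lemma withDensity [IsFiniteMeasure μ] (h : AtomlessMeasure μ) {g : T → ℝ≥0∞} (hg : Measurable g)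
    (hfin : ∫⁻ t, g t ∂μ ≠ ∞) : AtomlessMeasure (μ.withDensity g) := by
  have hpos : ∀ A, MeasurableSet A → (0 < μ.withDensity g A ↔ 0 < μ ({t | g t ≠ 0} ∩ A)) := by
    intro A hA
    rw [pos_iff_ne_zero, pos_iff_ne_zero, Ne, withDensity_apply_eq_zero hg]
  intro A hA hA0
  have hsupp : MeasurableSet {t | g t ≠ 0} := hg (measurableSet_singleton 0).compl
  obtain ⟨B, hBA, hB, hB0, hlt⟩ := h _ (hsupp.inter hA) ((hpos A hA).1 hA0)
  have hBA' : B ⊆ A := hBA.trans inter_subset_right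
  have hBfin : μ.withDensity g B ≠ ∞ := by
    rw [withDensity_apply _ hB]
    exact ne_top_of_le_ne_top hfin (setLIntegral_le_lintegral _ _)
  refine ⟨B, hBA', hB, ?_, ?_⟩
  · rwa [hpos B hB, inter_eq_self_of_subset_right (hBA.trans inter_subset_left)]
  · have hsum := measure_inter_add_sdiff (μ := μ.withDensity g) A hB
    rw [inter_eq_self_of_subset_right hBA'] at hsum
    rw [← hsum]
    refine ENNReal.lt_add_right hBfin ?_
    rw [← pos_iff_ne_zero, hpos _ (hA.diff hB), ← inter_sdiff_assoc,
      measure_sdiff hBA hB.nullMeasurableSet (measure_ne_top _ _)]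
    exact tsub_pos_of_lt hlt

/-- Two densities can be rearranged, without changing their sum or their integrals and without
enlarging their supports, so that they are supported on complementary sets. -/
lemma exists_exchange [IsFiniteMeasure μ] (h : AtomlessMeasure μ) {a b : T → ℝ≥0∞}
    (ha : Measurable a) (hb : Measurable b) (hfin : ∫⁻ t, (a t + b t) ∂μ ≠ ∞) :
    ∃ a' b' : T → ℝ≥0∞, Measurable a' ∧ Measurable b' ∧ (∀ t, a' t + b' t = a t + b t) ∧
      (∀ t, a t = 0 → a' t = 0) ∧ (∀ t, b t = 0 → b' t = 0) ∧ (∀ t, a' t = 0 ∨ b' t = 0) ∧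
      ∫⁻ t, b' t ∂μ = ∫⁻ t, b t ∂μ := by
  have hOa : MeasurableSet {t | a t ≠ 0} := ha (measurableSet_singleton 0).compl
  have hOb : MeasurableSet {t | b t ≠ 0} := hb (measurableSet_singleton 0).compl
  have hab : Measurable fun t => a t + b t := ha.add hb
  have : IsFiniteMeasure (μ.withDensity fun t => a t + b t) :=
    isFiniteMeasure_withDensity hfin
  have hle : ∫⁻ t in {t | a t ≠ 0} ∩ {t | b t ≠ 0}, b t ∂μ ≤
      μ.withDensity (fun t => a t + b t) ({t | a t ≠ 0} ∩ {t | b t ≠ 0}) := by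
    rw [withDensity_apply _ (hOa.inter hOb)]
    exact lintegral_mono fun t => le_add_self
  obtain ⟨A, hAO, hA, hAeq⟩ :=
    (h.withDensity hab hfin).exists_subset_measure_eq (hOa.inter hOb) hle
  rw [withDensity_apply _ hA] at hAeq
  have hA' : MeasurableSet (A ∪ {t | a t = 0}) := hA.union (ha (measurableSet_singleton 0))
  refine ⟨fun t => (A ∪ {t | a t = 0})ᶜ.indicator (fun t => a t + b t) t,
    fun t => (A ∪ {t | a t = 0}).indicator (fun t => a t + b t) t,
    hab.indicator hA'.compl, hab.indicator hA', fun t => ?_, fun t ht => ?_, fun t ht => ?_,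
    fun t => ?_, ?_⟩
  · rw [add_comm]
    exact congrFun (indicator_self_add_compl (A ∪ {t | a t = 0}) (fun t => a t + b t)) t
  · exact indicator_of_notMem (by simp [ht]) _
  · by_cases hat : a t = 0
    · simp [indicator, hat, ht]
    · refine indicator_of_notMem ?_ _
      rintro (htA | hta)
      · exact (hAO htA).2 ht
      · exact hat hta
  · by_cases ht : t ∈ A ∪ {t | a t = 0}
    · exact Or.inl (indicator_of_notMem (notMem_compl_iff.2 ht) _)
    · exact Or.inr (indicator_of_notMem ht _)
  · have hdisj : Disjoint A {t | a t = 0} := by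
      rw [disjoint_left]
      exact fun t ht h0 => (hAO ht).1 h0
    have hz : MeasurableSet {t | a t = 0} := ha (measurableSet_singleton 0)
    rw [lintegral_indicator hA', lintegral_union hz hdisj, hAeq,
      setLIntegral_congr_fun (g := b) hz (fun t ht => by simp only [mem_ofPred_eq] at ht; simp [ht]),
      ← lintegral_add_compl (μ := μ) b hz, add_comm, inter_comm, ← Measure.restrict_restrict hOb]
    congr 1
    rw [← lintegral_indicator hOb]
    congr with t
    by_cases hbt : b t = 0 <;> simp [indicator, hbt]

/-- In a countable family of densities summing to an indicator function, the first density can be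
turned into an indicator function, without changing any integral or enlarging any support. -/
lemma exists_peel [IsFiniteMeasure μ] (h : AtomlessMeasure μ) {g : ℕ → T → ℝ≥0∞}
    (hg : ∀ n, Measurable (g n)) {R : Set T} (hsum : ∀ t, ∑' n, g n t = R.indicator 1 t) :
    ∃ (R' : Set T) (g' : ℕ → T → ℝ≥0∞), MeasurableSet R' ∧ R' ⊆ R ∧ (∀ n, Measurable (g' n)) ∧
      (∀ t, ∑' n, g' n t = R'.indicator 1 t) ∧ (∀ n t, g (n + 1) t = 0 → g' n t = 0) ∧
      (∀ n, ∫⁻ t, g' n t ∂μ = ∫⁻ t, g (n + 1) t ∂μ) ∧ ∀ t ∈ R \ R', g 0 t ≠ 0 := by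
  have hgfin : ∀ n, ∫⁻ t, g n t ∂μ ≠ ∞ := by
    intro n
    refine ne_top_of_le_ne_top (measure_ne_top μ univ) ?_
    rw [← lintegral_one]
    refine lintegral_mono fun t => (ENNReal.le_tsum (f := fun n => g n t) n).trans ?_
    rw [hsum]
    exact indicator_le_self' (fun _ _ => zero_le) t
  let σ := {a : T → ℝ≥0∞ // Measurable a ∧ ∫⁻ t, a t ∂μ ≠ ∞}
  have hstep : ∀ (n : ℕ) (a : σ), ∃ (a' : σ) (b' : T → ℝ≥0∞), Measurable b' ∧
      (∀ t, a'.1 t + b' t = a.1 t + g (n + 1) t) ∧ (∀ t, a.1 t = 0 → a'.1 t = 0) ∧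
      (∀ t, g (n + 1) t = 0 → b' t = 0) ∧ (∀ t, a'.1 t = 0 ∨ b' t = 0) ∧
      ∫⁻ t, b' t ∂μ = ∫⁻ t, g (n + 1) t ∂μ := by
    intro n a
    have hfin : ∫⁻ t, (a.1 t + g (n + 1) t) ∂μ ≠ ∞ := by
      rw [lintegral_add_left a.2.1]
      exact ENNReal.add_ne_top.2 ⟨a.2.2, hgfin _⟩
    obtain ⟨a', b', ha', hb', hadd, H⟩ := h.exists_exchange a.2.1 (hg (n + 1)) hfin
    refine ⟨⟨a', ha', ne_top_of_le_ne_top hfin (lintegral_mono fun t => ?_)⟩, b', hb', hadd, H⟩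
    rw [← hadd]
    exact le_self_add
  choose next out hout hadd hnext hsupp hdisj hint using hstep
  let a : ℕ → σ := fun n => Nat.rec ⟨g 0, hg 0, hgfin 0⟩ next n
  let b : ℕ → T → ℝ≥0∞ := fun n => out n (a n)
  have hinv : ∀ n t, (a n).1 t + ∑ i ∈ Finset.range n, b i t + ∑' i, g (i + (n + 1)) t =
      R.indicator 1 t := by
    intro n t
    induction n with
    | zero =>
      rw [← hsum, tsum_eq_zero_add' (f := fun n => g n t) ENNReal.summable]
      simp [a]
    | succ n ih =>
      have hab : (a (n + 1)).1 t + b n t = (a n).1 t + g (n + 1) t := hadd n (a n) t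
      rw [← ih, Finset.sum_range_succ, tsum_eq_zero_add' (f := fun i => g (i + (n + 1)) t)
        ENNReal.summable, zero_add]
      simp only [add_right_comm _ 1 (n + 1), ← add_assoc]
      rw [add_right_comm _ _ (b n t), hab]
      simp only [add_assoc, add_left_comm, add_comm]
  have hle : ∀ t, ∑' n, b n t ≤ R.indicator 1 t := by
    refine fun t => ENNReal.tsum_le_of_sum_range_le fun n => ?_
    rw [← hinv n t]
    exact le_add_right le_add_self
  have hzero : ∀ t m n, m ≤ n → (a m).1 t = 0 → (a n).1 t = 0 := by
    intro t m n hmn hm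
    induction n, hmn using Nat.le_induction with
    | base => exact hm
    | succ n _ ih => exact hnext n (a n) t ih
  have heq : ∀ t m, (a m).1 t = 0 → ∑' n, b n t = R.indicator 1 t := by
    intro t m hm
    refine (hle t).antisymm ?_
    have hsumfin : ∑' n, g n t ≠ ∞ := by
      rw [hsum]
      exact ne_top_of_le_ne_top ENNReal.one_ne_top (indicator_le_self' (fun _ _ => zero_le) t)
    have hlim : Tendsto (fun n => ∑' i, b i t + ∑' i, g (i + (n + 1)) t) atTop
        (𝓝 (∑' i, b i t + 0)) :=
      tendsto_const_nhds.add ((tendsto_add_atTop_iff_nat 1).2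
        (ENNReal.tendsto_sum_nat_add (fun n => g n t) hsumfin))
    rw [add_zero] at hlim
    refine ge_of_tendsto hlim ((eventually_ge_atTop m).mono fun n hn => ?_)
    rw [← hinv n t, hzero t m n hn hm, zero_add]
    gcongr
    exact ENNReal.sum_le_tsum _
  have hS : Measurable fun t => ∑' n, b n t := .tsum fun n => hout n (a n)
  refine ⟨{t | ∑' n, b n t ≠ 0}, b, hS (measurableSet_singleton 0).compl, fun t ht => ?_,
    fun n => hout n (a n), fun t => ?_, fun n => hsupp n (a n), fun n => hint n (a n), ?_⟩
  · by_contra htR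
    have := hle t
    rw [indicator_of_notMem htR] at this
    exact ht (nonpos_iff_eq_zero.1 this)
  · by_cases ht : ∑' n, b n t = 0
    · rw [ht, indicator_of_notMem (by simpa using ht)]
    · obtain ⟨n, hn⟩ : ∃ n, b n t ≠ 0 := by simpa using ht
      have hmem : t ∈ {t | ∑' n, b n t ≠ 0} := ht
      have h1 := heq t (n + 1) ((hdisj n (a n) t).resolve_right hn)
      rw [indicator_of_mem hmem, h1, indicator_of_mem]
      by_contra htR
      rw [indicator_of_notMem htR] at h1
      exact ht h1
  · rintro t ⟨htR, ht⟩ h0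
    have h1 := heq t 0 h0
    rw [indicator_of_mem htR] at h1
    exact ht (show ∑' n, b n t ≠ 0 by simp only [h1, Pi.one_apply]; exact one_ne_zero)

/-- **Purification**: over a finite atomless measure, a countable family of densities summing to
`1` is realised by the level sets of a measurable function. -/
lemma exists_purification [IsFiniteMeasure μ] (h : AtomlessMeasure μ) {g : ℕ → T → ℝ≥0∞}
    (hg : ∀ n, Measurable (g n)) (hsum : ∀ t, ∑' n, g n t = 1) :
    ∃ f : T → ℕ, Measurable f ∧ (∀ᵐ t ∂μ, g (f t) t ≠ 0) ∧
      ∀ n, μ (f ⁻¹' {n}) = ∫⁻ t, g n t ∂μ := by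
  let σ := {p : Set T × (ℕ → T → ℝ≥0∞) // MeasurableSet p.1 ∧ (∀ n, Measurable (p.2 n)) ∧
    ∀ t, ∑' n, p.2 n t = p.1.indicator 1 t}
  have hstep : ∀ p : σ, ∃ q : σ, q.1.1 ⊆ p.1.1 ∧
      (∀ n t, p.1.2 (n + 1) t = 0 → q.1.2 n t = 0) ∧
      (∀ n, ∫⁻ t, q.1.2 n t ∂μ = ∫⁻ t, p.1.2 (n + 1) t ∂μ) ∧
      ∀ t ∈ p.1.1 \ q.1.1, p.1.2 0 t ≠ 0 := by
    rintro ⟨⟨R, k⟩, hR, hk, hks⟩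
    obtain ⟨R', k', hR', hsub, hk', hks', H⟩ := h.exists_peel hk hks
    exact ⟨⟨⟨R', k'⟩, hR', hk', hks'⟩, hsub, H⟩
  choose next hsub hsupp hint hpos using hstep
  let p : ℕ → σ := fun n => Nat.rec ⟨⟨univ, g⟩, .univ, hg, by simpa using hsum⟩ (fun _ => next) n
  have hanti : Antitone fun k => (p k).1.1 := antitone_nat_of_succ_le fun k => hsub (p k)
  have hsupp' : ∀ k n t, g (n + k) t = 0 → (p k).1.2 n t = 0 := by
    intro k
    induction k with
    | zero => exact fun n t ht => ht
    | succ k ih =>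
      intro n t ht
      refine hsupp (p k) n t (ih (n + 1) t ?_)
      rwa [add_right_comm]
  have hint' : ∀ k n, ∫⁻ t, (p k).1.2 n t ∂μ = ∫⁻ t, g (n + k) t ∂μ := by
    intro k
    induction k with
    | zero => exact fun n => rfl
    | succ k ih =>
      intro n
      rw [← add_assoc, add_right_comm, ← ih (n + 1)]
      exact hint (p k) n
  have hmass : ∀ q : σ, μ q.1.1 = ∑' n, ∫⁻ t, q.1.2 n t ∂μ := by
    intro q
    rw [← lintegral_tsum fun n => (q.2.2.1 n).aemeasurable, ← lintegral_indicator_one q.2.1]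
    exact lintegral_congr fun t => (q.2.2.2 t).symm
  let A : ℕ → Set T := fun k => (p k).1.1 \ (p (k + 1)).1.1
  have hA : ∀ k, MeasurableSet (A k) := fun k => (p k).2.1.diff (p (k + 1)).2.1
  have hμA : ∀ k, μ (A k) = ∫⁻ t, g k t ∂μ := by
    intro k
    rw [measure_sdiff (hsub (p k)) (p (k + 1)).2.1.nullMeasurableSet (measure_ne_top _ _)]
    refine ENNReal.sub_eq_of_eq_add (measure_ne_top _ _) ?_
    rw [hmass, hmass, tsum_eq_zero_add' ENNReal.summable, hint', zero_add]
    congr 1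
    exact tsum_congr fun n => (hint (p k) n).symm
  have hdisj : Pairwise (Function.onFun Disjoint A) := by
    refine (pairwise_disjoint_on A).2 fun m n hmn => ?_
    exact disjoint_left.2 fun t hm hn => hm.2 (hanti (Nat.succ_le_of_lt hmn) hn.1)
  have hcover : ∀ᵐ t ∂μ, t ∈ ⋃ k, A k := by
    rw [ae_mem_iff_measure_eq (MeasurableSet.iUnion hA).nullMeasurableSet,
      measure_iUnion hdisj hA, tsum_congr hμA]
    exact (hmass (p 0)).symm
  obtain ⟨f, hf, hfA⟩ := exists_measurable_piecewise A hA (fun n _ => n)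
    (fun n => measurable_const)
    fun m n hmn t ht => absurd ht.2 ((hdisj hmn).notMem_of_mem_left ht.1)
  refine ⟨f, hf, ?_, fun n => ?_⟩
  · filter_upwards [hcover] with t ht
    obtain ⟨k, hk⟩ := mem_iUnion.1 ht
    rw [hfA k hk]
    exact fun h0 => hpos (p k) t hk (hsupp' k 0 t (by rwa [zero_add]))
  · rw [← hμA]
    refine measure_congr ?_
    filter_upwards [hcover] with t ht
    obtain ⟨k, hk⟩ := mem_iUnion.1 ht
    refine propext ⟨fun hn => ?_, fun hn => hfA n hn⟩
    have : n = k := hn.symm.trans (hfA k hk)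
    exact this ▸ hk

end AtomlessMeasure

/-- Null sets of measurable rectangles with open second side survive weak limits of couplings with
a prescribed first marginal. -/
lemma isClosed_setOfPred_fst_eq_and_prod_null {X Y : Type*}
    [TopologicalSpace X] [SecondCountableTopology X] [TopologicalSpace.PseudoMetrizableSpace X]
    [MeasurableSpace X] [BorelSpace X]
    [TopologicalSpace Y] [SecondCountableTopology Y] [TopologicalSpace.PseudoMetrizableSpace Y]
    [MeasurableSpace Y] [BorelSpace Y]
    (m : Measure X) [IsProbabilityMeasure m] {S : Set X} (hS : MeasurableSet S)
    {V : Set Y} (hV : IsOpen V) :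
    IsClosed {π : ProbabilityMeasure (X × Y) |
      (π : Measure (X × Y)).fst = m ∧ (π : Measure (X × Y)) (S ×ˢ V) = 0} := by
  have hfst : IsClosed {π : ProbabilityMeasure (X × Y) | (π : Measure (X × Y)).fst = m} := by
    convert isClosed_eq (ProbabilityMeasure.continuous_map (Ω := X × Y) continuous_fst)
      (continuous_const (y := (⟨m, inferInstance⟩ : ProbabilityMeasure X))) using 2
    funext π
    exact propext ⟨fun h => Subtype.ext h, fun h => congrArg Subtype.val h⟩
  refine isClosed_of_closure_subset fun π hπ => ?_
  have hπm := closure_minimal (fun _ h => h.1) hfst hπ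
  refine ⟨hπm, ?_⟩
  rw [mem_closure_iff_clusterPt] at hπ
  set Q := {π : ProbabilityMeasure (X × Y) |
      (π : Measure (X × Y)).fst = m ∧ (π : Measure (X × Y)) (S ×ˢ V) = 0}
  have : (𝓝 π ⊓ 𝓟 Q).NeBot := hπ
  refine nonpos_iff_eq_zero.1 (ENNReal.le_of_forall_pos_le_add fun ε hε _ => ?_)
  obtain ⟨O, hSO, hO, -, hlt⟩ := hS.exists_isOpen_sdiff_lt (measure_ne_top m S)
    (ENNReal.coe_ne_zero.2 hε.ne')
  have hlim : Tendsto id (𝓝 π ⊓ 𝓟 Q) (𝓝 π) := inf_le_left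
  have hev : ∀ᶠ ρ : ProbabilityMeasure (X × Y) in 𝓝 π ⊓ 𝓟 Q,
      (ρ : Measure (X × Y)) (O ×ˢ V) ≤ ε := by
    filter_upwards [mem_inf_of_right (mem_principal_self Q)] with ρ hρ
    calc (ρ : Measure (X × Y)) (O ×ˢ V)
        ≤ (ρ : Measure (X × Y)) (Prod.fst ⁻¹' (O \ S) ∪ S ×ˢ V) := by
          refine measure_mono fun p hp => ?_
          by_cases hpS : p.1 ∈ S
          · exact Or.inr ⟨hpS, hp.2⟩
          · exact Or.inl ⟨hp.1, hpS⟩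
      _ ≤ (ρ : Measure (X × Y)) (Prod.fst ⁻¹' (O \ S)) + (ρ : Measure (X × Y)) (S ×ˢ V) :=
          measure_union_le _ _
      _ = m (O \ S) := by
          rw [hρ.2, add_zero, ← Measure.fst_apply (hO.measurableSet.diff hS), hρ.1]
      _ ≤ ε := hlt.le
  calc (π : Measure (X × Y)) (S ×ˢ V) ≤ (π : Measure (X × Y)) (O ×ˢ V) := by gcongr
    _ ≤ (𝓝 π ⊓ 𝓟 Q).liminf fun ρ : ProbabilityMeasure (X × Y) => (ρ : Measure (X × Y)) (O ×ˢ V) :=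
      ProbabilityMeasure.le_liminf_measure_open_of_tendsto hlim (hO.prod hV)
    _ ≤ (𝓝 π ⊓ 𝓟 Q).liminf fun _ => (ε : ℝ≥0∞) := liminf_le_liminf hev
    _ = 0 + ε := by rw [liminf_const, zero_add]

/-- A measurable compact-valued correspondence into a countable complete metric space takes its
values inside a single compact set, up to a set of small measure. -/
lemma exists_isCompact_measure_not_subset_le {T Y : Type*} [MeasurableSpace T] [MetricSpace Y]
    [Countable Y] [CompleteSpace Y] (μ : Measure T) [IsFiniteMeasure μ] (F : T → Set Y)
    (hmeas : ∀ y : Y, MeasurableSet {t : T | y ∈ F t}) (hcompact : ∀ t, IsCompact (F t))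
    {ε : ℝ≥0∞} (hε : ε ≠ 0) :
    ∃ K : Set Y, IsCompact K ∧ μ {t | ¬ F t ⊆ K} ≤ ε := by
  obtain ⟨e, he⟩ := exists_injective_nat Y
  let U : ℕ → ℕ → Set Y := fun k n => ⋃ z ∈ {z | e z < n}, Metric.ball z (1 / (k + 1 : ℝ))
  have hUo : ∀ k n, IsOpen (U k n) := fun k n => isOpen_biUnion fun z _ => Metric.isOpen_ball
  have hUm : ∀ k, Monotone (U k) := fun k n n' hn =>
    biUnion_subset_biUnion_left fun z (hz : e z < n) => hz.trans_le hn
  have hUc : ∀ k, ⋃ n, U k n = univ := by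
    refine fun k => eq_univ_of_forall fun y => mem_iUnion.2 ⟨e y + 1, ?_⟩
    exact mem_biUnion (show e y < e y + 1 from Nat.lt_succ_self _)
      (Metric.mem_ball_self (by positivity))
  have hfin : ∀ n, {z | e z < n}.Finite := fun n => (finite_Iio n).preimage he.injOn
  obtain ⟨δ, hδ, hδε⟩ := ENNReal.exists_pos_sum_of_countable' hε ℕ
  have hsmall : ∀ k, ∃ n, μ {t | ¬ F t ⊆ U k n} < δ k := by
    intro k
    have hms : ∀ n, MeasurableSet {t | ¬ F t ⊆ U k n} := by
      intro n
      have : {t | ¬ F t ⊆ U k n} = ⋃ z ∈ (U k n)ᶜ, {t | z ∈ F t} := by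
        ext t
        simp [not_subset, and_comm]
      rw [this]
      exact .biUnion (to_countable _) fun z _ => hmeas z
    have hanti : Antitone fun n => {t | ¬ F t ⊆ U k n} :=
      fun n n' hn t ht hsub => ht (hsub.trans (hUm k hn))
    have hempty : ⋂ n, {t | ¬ F t ⊆ U k n} = ∅ := by
      refine eq_empty_of_forall_notMem fun t ht => ?_
      obtain ⟨n, hn⟩ := (hcompact t).elim_directed_cover (U k) (hUo k)
        (by rw [hUc]; exact subset_univ _) (hUm k).directed_le
      exact mem_iInter.1 ht n hn
    have hlim := tendsto_measure_iInter_atTop (μ := μ) (fun n => (hms n).nullMeasurableSet) hanti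
      ⟨0, measure_ne_top _ _⟩
    rw [hempty, measure_empty] at hlim
    exact (hlim.eventually_lt_const (hδ k)).exists
  choose N hN using hsmall
  have htb : TotallyBounded (⋂ k, U k (N k)) := by
    refine Metric.totallyBounded_iff.2 fun r hr => ?_
    obtain ⟨k, hk⟩ := exists_nat_one_div_lt hr
    refine ⟨{z | e z < N k}, hfin _, (iInter_subset _ k).trans ?_⟩
    exact iUnion₂_mono fun z _ => Metric.ball_subset_ball hk.le
  refine ⟨closure (⋂ k, U k (N k)), htb.closure.isCompact_of_isClosed isClosed_closure, ?_⟩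
  calc μ {t | ¬ F t ⊆ closure (⋂ k, U k (N k))}
      ≤ μ (⋃ k, {t | ¬ F t ⊆ U k (N k)}) := by
        refine measure_mono fun t ht => ?_
        by_contra hcon
        refine ht ((subset_iInter fun k => ?_).trans subset_closure)
        by_contra hk
        exact hcon (mem_iUnion.2 ⟨k, hk⟩)
    _ ≤ ∑' k, μ {t | ¬ F t ⊆ U k (N k)} := measure_iUnion_le _
    _ ≤ ∑' k, δ k := ENNReal.tsum_le_tsum fun k => (hN k).le
    _ ≤ ε := hδε.le

/-- A coupling of the law of `φ` with a measure on a countable space is realised, over an atomless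
measure, by a measurable function charging only the same pairs. -/
lemma AtomlessMeasure.exists_map_eq_snd {T X Y : Type*} [MeasurableSpace T] [MeasurableSpace X]
    [MeasurableSpace Y] [Countable Y] [MeasurableSingletonClass Y] [Nonempty Y]
    {μ : Measure T} [IsFiniteMeasure μ] (h : AtomlessMeasure μ) {φ : T → X} (hφ : Measurable φ)
    {π : Measure (X × Y)} [IsFiniteMeasure π] (hπ : π.fst = μ.map φ) {p : X × Y → Prop}
    (hp : ∀ᵐ z ∂π, p z) :
    ∃ f : T → Y, Measurable f ∧ (∀ᵐ t ∂μ, p (φ t, f t)) ∧ π.snd = μ.map f := by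
  obtain ⟨e, he⟩ := exists_injective_nat Y
  have hem : Measurable e := measurable_of_countable e
  have hes : ∀ n, MeasurableSet (e ⁻¹' {n}) := fun n => hem (measurableSet_singleton n)
  obtain ⟨f, hf, hfpos, hfmass⟩ := h.exists_purification
    (g := fun n t => π.condKernel (φ t) (e ⁻¹' {n}))
    (fun n => (π.condKernel.measurable_coe (hes n)).comp hφ) fun t => by
      rw [← measure_iUnion (fun i j hij => Disjoint.preimage _ (by simpa using hij)) hes,
        ← preimage_iUnion, iUnion_of_singleton, preimage_univ, measure_univ]
  have hsupp : ∀ᵐ t ∂μ, ∀ᵐ y ∂π.condKernel (φ t), p (φ t, y) := by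
    refine ae_of_ae_map (p := fun x => ∀ᵐ y ∂π.condKernel x, p (x, y)) hφ.aemeasurable ?_
    rw [← hπ]
    refine Measure.ae_ae_of_ae_compProd ?_
    rwa [π.disintegrate]
  have hinv : Function.LeftInverse (Function.invFun e) e := Function.leftInverse_invFun he
  refine ⟨Function.invFun e ∘ f, measurable_from_nat.comp hf, ?_, ?_⟩
  · filter_upwards [hfpos, hsupp] with t hpos ht
    obtain ⟨y, hy, hpy⟩ : ∃ y ∈ e ⁻¹' {f t}, p (φ t, y) := by
      by_contra! hcon
      exact hpos (measure_mono_null hcon ht)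
    rw [Function.comp_apply, ← show e y = f t from hy, hinv]
    exact hpy
  · have hlaw : π.snd.map e = μ.map f := by
      refine Measure.ext_of_singleton fun n => ?_
      rw [Measure.map_apply hem (measurableSet_singleton n),
        Measure.map_apply hf (measurableSet_singleton n), hfmass, Measure.snd_apply (hes n),
        ← Measure.lintegral_condKernel_mem (measurable_snd (hes n)), hπ]
      exact lintegral_map (π.condKernel.measurable_coe (hes n)) hφ
    rw [← Measure.map_map measurable_from_nat hf, ← hlaw, Measure.map_map measurable_from_nat hem,
      hinv.comp_eq_id, Measure.map_id]

/-- The set of distributions of measurable selections of a compact-valued measurable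
correspondence is compact in the space of probability measures with the weak topology. -/
theorem stmt_8 {T Y : Type*} [MeasurableSpace T] [MetricSpace Y] [Countable Y]
    [CompleteSpace Y] [MeasurableSpace Y] [BorelSpace Y]
    (μ : Measure T) [IsProbabilityMeasure μ] (hatomless : AtomlessMeasure μ)
    (F : T → Set Y)
    (hmeas : ∀ y : Y, MeasurableSet {t : T | y ∈ F t})
    (hne : ∀ t, (F t).Nonempty) (hcompact : ∀ t, IsCompact (F t)) :
    IsCompact {ν : ProbabilityMeasure Y | ∃ f : T → Y, Measurable f ∧
      (∀ᵐ t ∂μ, f t ∈ F t) ∧ (ν : Measure Y) = μ.map f} := by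
  classical
  have : Nonempty Y := (nonempty_of_isProbabilityMeasure μ).elim fun t => ⟨(hne t).some⟩
  let φ : T → Y → Bool := fun t y => decide (y ∈ F t)
  have hφ : Measurable φ := by
    refine measurable_pi_lambda _ fun y => measurable_to_bool ?_
    convert hmeas y using 1
    ext t
    simp [φ]
  have : IsProbabilityMeasure (μ.map φ) := Measure.isProbabilityMeasure_map hφ.aemeasurable
  have hcoord : ∀ (y : Y) (b : Bool), MeasurableSet {x : Y → Bool | x y = b} := fun y b =>
    measurableSet_eq_fun (measurable_pi_apply y) measurable_const
  let S : Y → ℕ → Set (Y → Bool) :=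
    fun y n => {x | ∀ z ∈ Metric.ball y (1 / (n + 1 : ℝ)), x z = false}
  have hS : ∀ y n, MeasurableSet (S y n) := by
    intro y n
    have : S y n = ⋂ z ∈ Metric.ball y (1 / (n + 1 : ℝ)), {x | x z = false} := by
      ext x
      simp [S]
    rw [this]
    exact .biInter (to_countable _) fun z _ => hcoord z false
  let Q : Set (ProbabilityMeasure ((Y → Bool) × Y)) := ⋂ (y : Y) (n : ℕ),
    {π | (π : Measure ((Y → Bool) × Y)).fst = μ.map φ ∧
      (π : Measure ((Y → Bool) × Y)) (S y n ×ˢ Metric.ball y (1 / (n + 1 : ℝ))) = 0}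
  have hQfst : ∀ π ∈ Q, (π : Measure ((Y → Bool) × Y)).fst = μ.map φ := fun π hπ =>
    (mem_iInter₂.1 hπ (Classical.arbitrary Y) 0).1
  have hQclosed : IsClosed Q := isClosed_iInter fun y => isClosed_iInter fun n =>
    isClosed_setOfPred_fst_eq_and_prod_null (μ.map φ) (hS y n) Metric.isOpen_ball
  have hQgraph : ∀ π ∈ Q, ∀ᵐ z ∂(π : Measure ((Y → Bool) × Y)), z.1 z.2 = true := by
    intro π hπ
    have hN : ∀ᵐ z ∂(π : Measure ((Y → Bool) × Y)), ∀ (y : Y) (n : ℕ),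
        z ∉ S y n ×ˢ Metric.ball y (1 / (n + 1 : ℝ)) :=
      ae_all_iff.2 fun y => ae_all_iff.2 fun n =>
        measure_eq_zero_iff_ae_notMem.1 (mem_iInter₂.1 hπ y n).2
    have hcl : ∀ᵐ x ∂(π : Measure ((Y → Bool) × Y)).fst, ∀ y, x y = false → ∃ n, x ∈ S y n := by
      rw [hQfst π hπ, ae_map_iff hφ.aemeasurable]
      · refine ae_of_all _ fun t y hy => ?_
        have hyF : (F t)ᶜ ∈ 𝓝 y :=
          (hcompact t).isClosed.isOpen_compl.mem_nhds (by simpa [φ] using hy)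
        obtain ⟨r, hr, hball⟩ := Metric.mem_nhds_iff.1 hyF
        obtain ⟨n, hn⟩ := exists_nat_one_div_lt hr
        refine ⟨n, fun z hz => ?_⟩
        simpa [φ] using hball (Metric.ball_subset_ball hn.le hz)
      · have : {x : Y → Bool | ∀ y, x y = false → ∃ n, x ∈ S y n} =
            ⋂ y, ({x | x y = false}ᶜ ∪ ⋃ n, S y n) := by
          ext x
          simp [imp_iff_not_or]
        rw [this]
        exact .iInter fun y => (hcoord y false).compl.union (.iUnion (hS y))
    filter_upwards [hN, ae_of_ae_map measurable_fst.aemeasurable hcl] with z hz hz'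
    by_contra hfalse
    obtain ⟨n, hn⟩ := hz' z.2 (by simpa using hfalse)
    exact hz z.2 n ⟨hn, Metric.mem_ball_self (by positivity)⟩
  have hQtight : IsTightMeasureSet
      {((π : ProbabilityMeasure ((Y → Bool) × Y)) : Measure ((Y → Bool) × Y)) | π ∈ Q} := by
    refine isTightMeasureSet_iff_exists_isCompact_measure_compl_le.2 fun ε hε => ?_
    obtain ⟨K, hK, hμK⟩ :=
      exists_isCompact_measure_not_subset_le μ F hmeas hcompact hε.ne'
    refine ⟨univ ×ˢ K, isCompact_univ.prod hK, ?_⟩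
    rintro _ ⟨π, hπ, rfl⟩
    have hms : MeasurableSet {x : Y → Bool | ∃ y, y ∉ K ∧ x y = true} := by
      have : {x : Y → Bool | ∃ y, y ∉ K ∧ x y = true} = ⋃ y ∈ Kᶜ, {x | x y = true} := by
        ext x
        simp
      rw [this]
      exact .biUnion (to_countable _) fun y _ => hcoord y true
    calc (π : Measure ((Y → Bool) × Y)) (univ ×ˢ K)ᶜ
        ≤ (π : Measure ((Y → Bool) × Y)) (Prod.fst ⁻¹' {x | ∃ y, y ∉ K ∧ x y = true}) := by
          refine measure_mono_ae ?_
          filter_upwards [hQgraph π hπ] with z hz hzK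
          exact ⟨z.2, fun h => hzK ⟨mem_univ _, h⟩, hz⟩
      _ = μ {t | ¬ F t ⊆ K} := by
          rw [← Measure.fst_apply hms, hQfst π hπ, Measure.map_apply hφ hms]
          congr 1
          ext t
          simp [φ, not_subset, and_comm]
      _ ≤ ε := hμK
  have hQcompact : IsCompact Q :=
    hQclosed.closure_eq ▸ isCompact_closure_of_isTightMeasureSet hQtight
  convert hQcompact.image
    (ProbabilityMeasure.continuous_map (Ω := (Y → Bool) × Y) continuous_snd) using 1
  ext ν
  constructor
  · rintro ⟨f, hf, hfF, hν⟩
    have hφf : Measurable fun t => (φ t, f t) := hφ.prodMk hf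
    refine ⟨⟨μ.map fun t => (φ t, f t), Measure.isProbabilityMeasure_map hφf.aemeasurable⟩,
      mem_iInter₂.2 fun y n => ⟨?_, ?_⟩, Subtype.ext ?_⟩
    · exact Measure.fst_map_prodMk hf
    · rw [ProbabilityMeasure.coe_mk,
        Measure.map_apply hφf ((hS y n).prod Metric.isOpen_ball.measurableSet)]
      refine measure_eq_zero_iff_ae_notMem.2 ?_
      filter_upwards [hfF] with t ht hmem
      simpa [φ, ht] using hmem.1 (f t) hmem.2
    · exact (Measure.snd_map_prodMk hφ).trans hν.symm
  · rintro ⟨π, hπ, rfl⟩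
    obtain ⟨f, hf, hfF, hlaw⟩ :=
      hatomless.exists_map_eq_snd hφ (hQfst π hπ) (hQgraph π hπ)
    exact ⟨f, hf, hfF.mono fun t ht => by simpa [φ] using ht, hlaw⟩
end

section
/- Let X be a metric space, (T, 𝒯, λ) an atomless probability space, Y a countable complete metric space, and F : T × X → Set Y a correspondence such that: (i) for each fixed x ∈ X, F(·, x) is a compact-valued measurable correspondence with nonempty values; (ii) for each fixed t ∈ T, F(t, ·) is upper semicontinuous; (iii) there exists a compact-valued correspondence H : T → Set Y with F(t, x) ⊆ H(t) for all t and x. Then the correspondence x ↦ D_{F(·,x)} = {λ ∘ f⁻¹ : f a measurable selection of F(·, x)} from X into M(Y) (with the weak topology) is upper semicontinuous. -/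
open MeasureTheory

/-- A correspondence `G : X → Set Z` is upper semicontinuous. -/
def UpperSemicontinuousCorr {X Z : Type*} [TopologicalSpace X] [TopologicalSpace Z]
    (G : X → Set Z) : Prop :=
  ∀ x : X, ∀ V : Set Z, IsOpen V → G x ⊆ V →
    ∃ U : Set X, IsOpen U ∧ x ∈ U ∧ ∀ y ∈ U, G y ⊆ V

open Filter Set Topology

/-- In a preorder whose decreasing sequences have lower bounds, a monotone real function which is
bounded below becomes constant below some element. -/
lemma exists_le_forall_le_eq {α : Type*} [Preorder α] {Φ : α → ℝ} (hΦ : Monotone Φ)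
    (hbdd : BddBelow (range Φ)) (hseq : ∀ u : ℕ → α, Antitone u → ∃ b, ∀ n, b ≤ u n) (a : α) :
    ∃ m ≤ a, ∀ b ≤ m, Φ b = Φ m := by
  have hnext (n : ℕ) (c : α) : ∃ b ≤ c, Φ b < sInf (Φ '' Iic c) + 1 / ((n : ℝ) + 1) := by
    obtain ⟨_, ⟨b, hb, rfl⟩, hlt⟩ := exists_lt_of_csInf_lt (s := Φ '' Iic c)
      ⟨Φ c, c, le_rfl, rfl⟩ (lt_add_of_pos_right _ (Nat.one_div_pos_of_nat (n := n)))
    exact ⟨b, hb, hlt⟩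
  choose next hle hlt using hnext
  let u : ℕ → α := fun n => Nat.rec a next n
  obtain ⟨m, hm⟩ := hseq u (antitone_nat_of_succ_le fun n => hle n (u n))
  refine ⟨m, hm 0, fun b hb => le_antisymm (hΦ hb) ?_⟩
  refine ge_of_tendsto' (x := atTop) (f := fun n : ℕ => Φ b + 1 / ((n : ℝ) + 1)) ?_ fun n => ?_
  · simpa using tendsto_one_div_add_atTop_nhds_zero_nat.const_add (Φ b)
  · have h₁ : Φ m ≤ Φ (u (n + 1)) := hΦ (hm (n + 1))
    have h₂ : sInf (Φ '' Iic (u n)) ≤ Φ b :=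
      csInf_le (hbdd.mono (image_subset_range _ _)) ⟨b, hb.trans (hm n), rfl⟩
    have h₃ : Φ (u (n + 1)) < sInf (Φ '' Iic (u n)) + 1 / ((n : ℝ) + 1) := hlt n (u n)
    linarith

/-- The measure-theoretic Hall condition: every finite subfamily has a union at least as large as
its total demand. -/
def HallCondition {T ι : Type*} [MeasurableSpace T] (μ : Measure T) (p : ι → ℝ)
    (A : ι → Set T) : Prop :=
  ∀ I : Finset ι, ∑ i ∈ I, p i ≤ μ.real (⋃ i ∈ I, A i)

/-- A nonnull set of an atomless finite measure contains nonnull subsets of small measure. -/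
lemma AtomlessMeasure.exists_subset_real_lt {T : Type*} [MeasurableSpace T] {μ : Measure T}
    [IsFiniteMeasure μ] (hμ : AtomlessMeasure μ) {A : Set T} (hA : MeasurableSet A)
    (hpos : 0 < μ.real A) {ε : ℝ} (hε : 0 < ε) :
    ∃ E ⊆ A, MeasurableSet E ∧ 0 < μ.real E ∧ μ.real E < ε := by
  have hhalf : ∀ C : Set T, MeasurableSet C → 0 < μ.real C →
      ∃ E ⊆ C, MeasurableSet E ∧ 0 < μ.real E ∧ μ.real E ≤ μ.real C / 2 := by
    intro C hC hCpos
    obtain ⟨B, hBC, hB, hBpos, hBlt⟩ := hμ C hC (by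
      simpa [measureReal_def, ENNReal.toReal_pos_iff] using hCpos)
    have h₁ : 0 < μ.real B := ENNReal.toReal_pos hBpos.ne' (measure_ne_top _ _)
    have h₂ : μ.real B < μ.real C :=
      (ENNReal.toReal_lt_toReal (measure_ne_top _ _) (measure_ne_top _ _)).2 hBlt
    have h₃ : μ.real (C \ B) = μ.real C - μ.real B := measureReal_sdiff hBC hB
    rcases le_total (μ.real B) (μ.real C / 2) with h | h
    · exact ⟨B, hBC, hB, h₁, h⟩
    · exact ⟨C \ B, sdiff_subset, hC.diff hB, by linarith, by linarith⟩
  have hpow : ∀ n : ℕ, ∃ E ⊆ A, MeasurableSet E ∧ 0 < μ.real E ∧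
      μ.real E ≤ μ.real A * (1 / 2) ^ n := by
    intro n
    induction n with
    | zero => exact ⟨A, Subset.rfl, hA, hpos, by simp⟩
    | succ n ih =>
      obtain ⟨C, hCA, hC, hCpos, hCle⟩ := ih
      obtain ⟨E, hEC, hE, hEpos, hEle⟩ := hhalf C hC hCpos
      exact ⟨E, hEC.trans hCA, hE, hEpos, by rw [pow_succ]; linarith⟩
  obtain ⟨n, hn⟩ := exists_pow_lt_of_lt_one (div_pos hε hpos) (by norm_num : (1 / 2 : ℝ) < 1)
  obtain ⟨E, hEA, hE, hEpos, hEle⟩ := hpow n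
  refine ⟨E, hEA, hE, hEpos, hEle.trans_lt ?_⟩
  rwa [lt_div_iff₀ hpos, mul_comm] at hn

/-- The Hall condition passes to decreasing countable intersections. -/
lemma HallCondition.iInter {T ι : Type*} [MeasurableSpace T] {μ : Measure T} [IsFiniteMeasure μ]
    {p : ι → ℝ} {A : ℕ → ι → Set T} (hA : Antitone A) (hmeas : ∀ n i, MeasurableSet (A n i))
    (h : ∀ n, HallCondition μ p (A n)) : HallCondition μ p (fun i => ⋂ n, A n i) := by
  intro I
  have hset : (⋃ i ∈ I, ⋂ n, A n i) = ⋂ n, ⋃ i ∈ I, A n i := by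
    have := Set.iInter_iUnion_of_antitone (ι := I) (ι' := ℕ) (s := fun i n => A n i)
      fun i m n hmn => hA hmn i
    simpa [iUnion_subtype] using this.symm
  rw [hset]
  have hlim := tendsto_measure_iInter_atTop (μ := μ) (s := fun n => ⋃ i ∈ I, A n i)
    (fun n => (I.measurableSet_biUnion fun i _ => hmeas n i).nullMeasurableSet)
    (fun m n hmn => iUnion₂_mono fun i _ => hA hmn i) ⟨0, measure_ne_top _ _⟩
  exact ge_of_tendsto' ((ENNReal.tendsto_toReal (measure_ne_top _ _)).comp hlim) fun n => h n I

/-- A measurable family satisfying the Hall condition can be shrunk to one which is minimal modulo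
null sets. -/
lemma HallCondition.exists_minimal {T ι : Type*} [MeasurableSpace T] [Countable ι]
    {μ : Measure T} [IsProbabilityMeasure μ] {p : ι → ℝ} {A : ι → Set T}
    (hmeas : ∀ i, MeasurableSet (A i)) (h : HallCondition μ p A) :
    ∃ B ≤ A, (∀ i, MeasurableSet (B i)) ∧ HallCondition μ p B ∧
      ∀ C ≤ B, (∀ i, MeasurableSet (C i)) → HallCondition μ p C →
        ∀ i, μ.real (C i) = μ.real (B i) := by
  obtain ⟨w, hwpos, c, hw, -⟩ := NNReal.exists_pos_sum_of_countable one_ne_zero ι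
  have hw' : Summable fun i => (w i : ℝ) := NNReal.summable_coe.2 hw.summable
  let α := {B : ι → Set T // (∀ i, MeasurableSet (B i)) ∧ HallCondition μ p B}
  let Φ : α → ℝ := fun B => ∑' i, (w i : ℝ) * μ.real (B.1 i)
  have hsum (B : α) : Summable fun i => (w i : ℝ) * μ.real (B.1 i) :=
    hw'.of_nonneg_of_le (fun i => by positivity)
      fun i => mul_le_of_le_one_right (w i).2 measureReal_le_one
  have hterm {B C : α} (hBC : B ≤ C) (i : ι) : (w i : ℝ) * μ.real (B.1 i) ≤ w i * μ.real (C.1 i) :=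
    mul_le_mul_of_nonneg_left (measureReal_mono (hBC i)) (w i).2
  have hΦ : Monotone Φ := fun B C hBC => (hsum B).tsum_le_tsum (hterm hBC) (hsum C)
  have hbdd : BddBelow (range Φ) := by
    refine ⟨0, ?_⟩
    rintro _ ⟨B, rfl⟩
    exact tsum_nonneg fun i => by positivity
  have hseq (u : ℕ → α) (hu : Antitone u) : ∃ b, ∀ n, b ≤ u n :=
    ⟨⟨fun i => ⋂ n, (u n).1 i, fun i => .iInter fun n => (u n).2.1 i,
      HallCondition.iInter (A := fun n => (u n).1) (fun m n hmn => hu hmn) (fun n => (u n).2.1)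
        fun n => (u n).2.2⟩,
      fun n i => iInter_subset _ n⟩
  obtain ⟨B, hBA, hB⟩ := exists_le_forall_le_eq hΦ hbdd hseq ⟨A, hmeas, h⟩
  refine ⟨B.1, hBA, B.2.1, B.2.2, fun C hCB hC hCH i => ?_⟩
  have heq := hB ⟨C, hC, hCH⟩ hCB
  refine le_antisymm (measureReal_mono (hCB i)) (not_lt.1 fun hlt => heq.not_lt ?_)
  exact (hsum ⟨C, hC, hCH⟩).tsum_lt_tsum (hterm (B := ⟨C, hC, hCH⟩) hCB)
    (mul_lt_mul_of_pos_left hlt (hwpos i)) (hsum B)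

/-- In a minimal family satisfying the Hall condition over an atomless measure, each set has exactly
the demanded measure. -/
lemma HallCondition.real_eq_of_minimal {T ι : Type*} [MeasurableSpace T]
    {μ : Measure T} [IsProbabilityMeasure μ] (hμ : AtomlessMeasure μ) {p : ι → ℝ}
    (hp : ∀ i, 0 ≤ p i) {B : ι → Set T} (hmeas : ∀ i, MeasurableSet (B i))
    (h : HallCondition μ p B)
    (hmin : ∀ C ≤ B, (∀ i, MeasurableSet (C i)) → HallCondition μ p C →
      ∀ i, μ.real (C i) = μ.real (B i)) (i : ι) : μ.real (B i) = p i := by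
  classical
  let U : Finset ι → Set T := fun I => ⋃ j ∈ I, B j
  have hU (I : Finset ι) : MeasurableSet (U I) := I.measurableSet_biUnion fun j _ => hmeas j
  let s : Finset ι → ℝ := fun I => μ.real (B i ∪ U I) - p i - ∑ j ∈ I, p j
  have hs {I : Finset ι} (hI : i ∉ I) : 0 ≤ s I := by
    have := h (insert i I)
    rw [Finset.sum_insert hI, Finset.set_biUnion_insert] at this
    simp only [s, U]
    linarith
  have hremove (E : Set T) (hEB : E ⊆ B i) (hE : MeasurableSet E) (hpos : 0 < μ.real E) :
      ∃ J : Finset ι, i ∉ J ∧ s J < μ.real (E \ U J) := by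
    by_contra! hcon
    have hle : Function.update B i (B i \ E) ≤ B := by
      exact update_le_iff.2 ⟨sdiff_subset, fun _ _ => le_rfl⟩
    have heq := hmin _ hle (fun j => ?_) (fun J => ?_) i
    · rw [Function.update_self, measureReal_sdiff hEB hE] at heq
      linarith
    · rcases eq_or_ne j i with rfl | hj
      · simpa using (hmeas j).diff hE
      · simpa [hj] using hmeas j
    · have hupd (I : Finset ι) (hI : i ∉ I) :
          (⋃ j ∈ I, Function.update B i (B i \ E) j) = U I :=
        iUnion₂_congr fun j hj => Function.update_of_ne (ne_of_mem_of_not_mem hj hI) _ _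
      by_cases hJ : i ∈ J
      · rw [← Finset.insert_erase hJ, Finset.sum_insert (J.notMem_erase i),
          Finset.set_biUnion_insert, hupd _ (J.notMem_erase i), Function.update_self]
        have h₁ := hcon (J.erase i) (J.notMem_erase i)
        have h₂ : μ.real (B i ∪ U (J.erase i)) ≤
            μ.real (B i \ E ∪ U (J.erase i)) + μ.real (E \ U (J.erase i)) := by
          refine (measureReal_mono fun t ht => ?_).trans (measureReal_union_le _ _)
          by_cases htE : t ∈ E <;> by_cases htU : t ∈ U (J.erase i) <;> simp_all
        simp only [s] at h₁
        linarith
      · rw [hupd J hJ]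
        exact h J
  have hsub {I J : Finset ι} (hI : i ∉ I) (hJ : i ∉ J) : s (I ∩ J) ≤ s I + s J := by
    have h₁ : 0 ≤ s (I ∪ J) := hs (by simp [hI, hJ])
    have h₂ := measureReal_union_add_inter (μ := μ) (s := B i ∪ U I) ((hmeas i).union (hU J))
    have h₃ : μ.real (B i ∪ U (I ∩ J)) ≤ μ.real ((B i ∪ U I) ∩ (B i ∪ U J)) := by
      rw [← union_inter_distrib_left]
      refine measureReal_mono (union_subset_union_right _ (subset_inter ?_ ?_))
      · exact biUnion_subset_biUnion_left fun j hj => (Finset.mem_inter.1 hj).1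
      · exact biUnion_subset_biUnion_left fun j hj => (Finset.mem_inter.1 hj).2
    have h₄ : B i ∪ U (I ∪ J) = B i ∪ U I ∪ (B i ∪ U J) := by
      rw [← union_union_distrib_left]
      congr 1
      exact Finset.set_biUnion_union I J B
    have h₅ := Finset.sum_union_inter (s₁ := I) (s₂ := J) (f := p)
    rw [← h₄] at h₂
    simp only [s] at h₁ ⊢
    linarith
  have hs0 : s ∅ = μ.real (B i) - p i := by simp [s, U]
  have hclaim (I : Finset ι) (hI : i ∉ I) : s ∅ ≤ s I := by
    induction I using Finset.strongInduction with
    | H I ih =>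
      by_cases hnull : ∀ j ∈ I, μ (B i ∩ B j) = 0
      · have h₁ : μ.real (B i ∩ U I) = 0 := by
          rw [measureReal_eq_zero_iff, inter_iUnion₂]
          exact (measure_biUnion_null_iff I.countable_toSet).2 hnull
        have h₂ := measureReal_union_add_inter (μ := μ) (s := B i) (hU I)
          (measure_ne_top _ _) (measure_ne_top _ _)
        have h₃ := h I
        simp only [hs0, s]
        linarith
      · push Not at hnull
        obtain ⟨j, hjI, hj⟩ := hnull
        refine le_of_forall_pos_le_add fun ε hε => ?_
        obtain ⟨E, hEsub, hE, hEpos, hElt⟩ := hμ.exists_subset_real_lt ((hmeas i).inter (hmeas j))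
          (ENNReal.toReal_pos hj (measure_ne_top _ _)) hε
        obtain ⟨J, hJ, hsJ⟩ := hremove E (hEsub.trans inter_subset_left) hE hEpos
        have hjJ : j ∉ J := fun hjJ => by
          have : E \ U J = ∅ := sdiff_eq_empty.2 fun t ht => mem_biUnion hjJ (hEsub ht).2
          rw [this, measureReal_empty] at hsJ
          exact (hs hJ).not_gt hsJ
        have h₁ : s ∅ ≤ s (I ∩ J) := ih _
          (Finset.ssubset_iff_subset_ne.2 ⟨Finset.inter_subset_left, fun heq =>
            hjJ (Finset.mem_inter.1 (heq.symm ▸ hjI)).2⟩) (by simp [hI])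
        have h₂ := hsub hI hJ
        have h₃ : μ.real (E \ U J) ≤ μ.real E := measureReal_mono sdiff_subset
        linarith
  have hge : 0 ≤ s ∅ := hs (by simp)
  by_contra hne
  have hpos : 0 < s ∅ := lt_of_le_of_ne hge fun h0 => hne (by linarith)
  obtain ⟨E, hEB, hE, hEpos, hElt⟩ := hμ.exists_subset_real_lt (hmeas i)
    (by linarith [hp i]) hpos
  obtain ⟨J, hJ, hsJ⟩ := hremove E hEB hE hEpos
  have h₁ : μ.real (E \ U J) ≤ μ.real E := measureReal_mono sdiff_subset
  linarith [hclaim J hJ]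

/-- Hall's marriage theorem for countable families over an atomless probability measure: a
probability law on a countable space dominated on finite sets is the law of a selection. -/
lemma AtomlessMeasure.exists_measurable_selection_map_eq {T Y : Type*} [MeasurableSpace T]
    [Countable Y] [MeasurableSpace Y] [MeasurableSingletonClass Y]
    {μ : Measure T} [IsProbabilityMeasure μ] (hμ : AtomlessMeasure μ)
    {ν : Measure Y} [IsProbabilityMeasure ν] {A : Y → Set T} (hA : ∀ y, MeasurableSet (A y))
    (h : ∀ I : Finset Y, ν I ≤ μ (⋃ y ∈ I, A y)) :
    ∃ f : T → Y, Measurable f ∧ (∀ᵐ t ∂μ, t ∈ A (f t)) ∧ μ.map f = ν := by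
  have hHall : HallCondition μ (fun y => ν.real {y}) A := fun I => by
    rw [sum_measureReal_singleton]
    exact ENNReal.toReal_mono (measure_ne_top _ _) (h I)
  obtain ⟨B, hBA, hB, hBH, hBmin⟩ := hHall.exists_minimal hA
  have hBeq := hBH.real_eq_of_minimal hμ (fun _ => measureReal_nonneg) hB hBmin
  have hdisj : Pairwise (Function.onFun (AEDisjoint μ) B) := fun y z hyz => by
    classical
    have h₁ := hBH {y, z}
    rw [Finset.sum_pair hyz, Finset.set_biUnion_insert, Finset.set_biUnion_singleton,
      ← hBeq y, ← hBeq z, ← measureReal_union_add_inter (hB z)] at h₁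
    exact (measureReal_eq_zero_iff).1 (le_antisymm (by linarith) measureReal_nonneg)
  obtain ⟨N, hN, hN0, hNdisj⟩ := exists_null_pairwise_disjoint_sdiff hdisj
  have : Nonempty Y := nonempty_of_isProbabilityMeasure ν
  obtain ⟨f, hf, hfB⟩ := exists_measurable_piecewise (fun y => B y \ N y)
    (fun y => (hB y).diff (hN y)) (fun y _ => y) (fun y => measurable_const)
    fun y z hyz t ht => (disjoint_left.1 (hNdisj hyz) ht.1 ht.2).elim
  have hmeas (y : Y) : μ (B y \ N y) = ν {y} := by
    rw [measure_sdiff_null (hN0 y)]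
    exact (measureReal_eq_measureReal_iff).1 (hBeq y)
  have hsubset (y : Y) : B y \ N y ⊆ f ⁻¹' {y} := fun t ht => hfB y ht
  have : IsProbabilityMeasure (μ.map f) := Measure.isProbabilityMeasure_map hf.aemeasurable
  have hmap : ν = μ.map f := by
    refine Measure.eq_of_le_of_measure_univ_eq (Measure.le_iff.2 fun S hS => ?_) (by simp)
    rw [← Measure.tsum_indicator_apply_singleton ν S hS,
      ← Measure.tsum_indicator_apply_singleton (μ.map f) S hS]
    refine ENNReal.tsum_le_tsum fun y => indicator_le_indicator ?_
    rw [Measure.map_apply hf (measurableSet_singleton y), ← hmeas y]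
    exact measure_mono (hsubset y)
  refine ⟨f, hf, ?_, hmap.symm⟩
  have hae (y : Y) : ∀ᵐ t ∂μ, f t = y → t ∈ A y := by
    have h₀ : μ (f ⁻¹' {y} \ (B y \ N y)) = 0 := by
      rw [measure_sdiff (hsubset y) ((hB y).diff (hN y)).nullMeasurableSet (measure_ne_top _ _),
        ← Measure.map_apply hf (measurableSet_singleton y), ← hmap, hmeas, tsub_self]
    filter_upwards [compl_mem_ae_iff.2 h₀] with t ht hty
    by_contra htA
    exact ht ⟨hty, fun htB => htA (hBA y htB.1)⟩
  filter_upwards [ae_all_iff.2 hae] with t ht using ht _ rfl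

/-- The laws of a sequence of measurable maps which is pointwise relatively compact form a tight
set. -/
lemma isTightMeasureSet_range_map {T Y : Type*} [MeasurableSpace T] [MetricSpace Y]
    [CompleteSpace Y] [SecondCountableTopology Y] [MeasurableSpace Y] [BorelSpace Y]
    {μ : Measure T} [IsFiniteMeasure μ] {f : ℕ → T → Y} (hf : ∀ n, Measurable (f n))
    (h : ∀ᵐ t ∂μ, ∃ K : Set Y, IsCompact K ∧ ∀ n, f n t ∈ K) :
    IsTightMeasureSet (range fun n => μ.map (f n)) := by
  rw [isTightMeasureSet_iff_exists_isCompact_measure_compl_le]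
  intro ε hε
  rcases isEmpty_or_nonempty Y with hY | hY
  · exact ⟨∅, isCompact_empty, fun ν _ => by simp [Measure.eq_zero_of_isEmpty ν]⟩
  obtain ⟨D, hD⟩ := TopologicalSpace.exists_dense_seq Y
  obtain ⟨u, -, hu_pos, hu⟩ := exists_seq_strictAnti_tendsto (0 : ℝ)
  obtain ⟨δ, hδ_pos, hδ⟩ := ENNReal.exists_pos_sum_of_countable' hε.ne' ℕ
  let G : ℕ → ℕ → Set Y := fun m k => ⋃ i ∈ Iio k, Metric.ball (D i) (u m)
  have hGopen (m k : ℕ) : IsOpen (G m k) := isOpen_biUnion fun _ _ => Metric.isOpen_ball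
  have hGmono (m : ℕ) : Monotone (G m) :=
    fun k l hkl => biUnion_subset_biUnion_left (Iio_subset_Iio hkl)
  have hGcover (m : ℕ) : ⋃ k, G m k = univ := eq_univ_of_forall fun z => by
    obtain ⟨i, hi⟩ := hD.exists_dist_lt z (hu_pos m)
    exact mem_iUnion.2 ⟨i + 1, mem_biUnion (Nat.lt_succ_self i) hi⟩
  let S : ℕ → ℕ → Set T := fun m k => ⋃ n, f n ⁻¹' (G m k)ᶜ
  have hsmall (m : ℕ) : ∃ k, μ (S m k) < δ m := by
    have hanti : Antitone (S m) := fun k l hkl =>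
      iUnion_mono fun n => preimage_mono (compl_subset_compl.2 (hGmono m hkl))
    have hnull : μ (⋂ k, S m k) = 0 := by
      refine measure_mono_null (fun t ht => ?_) (ae_iff.1 h)
      rintro ⟨K, hK, hfK⟩
      obtain ⟨k, hk⟩ := hK.elim_directed_cover (G m) (hGopen m) (by simp [hGcover m])
        (hGmono m).directed_le
      obtain ⟨n, hn⟩ := mem_iUnion.1 (mem_iInter.1 ht k)
      exact hn (hk (hfK n))
    have hlim := tendsto_measure_iInter_atTop (μ := μ) (s := S m)
      (fun k => (MeasurableSet.iUnion fun n =>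
        hf n (hGopen m k).measurableSet.compl).nullMeasurableSet) hanti ⟨0, measure_ne_top _ _⟩
    rw [hnull] at hlim
    exact (hlim.eventually (gt_mem_nhds (hδ_pos m))).exists
  choose k hk using hsmall
  let K : Set Y := ⋂ m, ⋃ i ∈ Iio (k m), Metric.closedBall (D i) (u m)
  have hKclosed : IsClosed K := isClosed_iInter fun m =>
    (finite_Iio (k m)).isClosed_biUnion fun _ _ => Metric.isClosed_closedBall
  refine ⟨K, TotallyBounded.isCompact_of_isClosed ?_ hKclosed, ?_⟩
  · refine Metric.totallyBounded_iff.2 fun r hr => ?_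
    obtain ⟨m, hm⟩ := (hu.eventually (gt_mem_nhds hr)).exists
    refine ⟨D '' Iio (k m), (finite_Iio _).image _, ?_⟩
    rw [biUnion_image]
    exact (iInter_subset _ m).trans
      (iUnion₂_mono fun i _ => Metric.closedBall_subset_ball hm)
  · rintro _ ⟨n, rfl⟩
    rw [Measure.map_apply (hf n) hKclosed.measurableSet.compl]
    calc μ (f n ⁻¹' Kᶜ) ≤ μ (⋃ m, S m (k m)) := by
          refine measure_mono fun t ht => ?_
          simp only [K, mem_preimage, mem_compl_iff, mem_iInter, not_forall] at ht
          obtain ⟨m, hm⟩ := ht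
          refine mem_iUnion.2 ⟨m, mem_iUnion.2 ⟨n, fun hG => hm ?_⟩⟩
          exact iUnion₂_mono (fun i _ => Metric.ball_subset_closedBall) hG
      _ ≤ ∑' m, μ (S m (k m)) := measure_iUnion_le _
      _ ≤ ∑' m, δ m := ENNReal.tsum_le_tsum fun m => (hk m).le
      _ ≤ ε := hδ.le

/-- If the laws of `f n` converge weakly to `ρ` and `f n t` eventually enters every open
neighborhood of the compact set `G t`, then `ρ C` is at most the measure of the set of `t` for which
`G t` hits the compact set `C`. -/
lemma measure_le_of_tendsto_map {T Y : Type*} [MeasurableSpace T] [MetricSpace Y]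
    [MeasurableSpace Y] [BorelSpace Y] {μ : Measure T} [IsFiniteMeasure μ] {f : ℕ → T → Y}
    (hf : ∀ n, Measurable (f n)) {ν : ℕ → ProbabilityMeasure Y}
    (hν : ∀ n, (ν n : Measure Y) = μ.map (f n)) {ρ : ProbabilityMeasure Y}
    (hρ : Tendsto ν atTop (𝓝 ρ)) {G : T → Set Y} (hG : ∀ t, IsCompact (G t))
    (hlim : ∀ᵐ t ∂μ, ∀ W, IsOpen W → G t ⊆ W → ∀ᶠ n in atTop, f n t ∈ W)
    {C : Set Y} (hC : IsCompact C) :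
    (ρ : Measure Y) C ≤ μ {t | (G t ∩ C).Nonempty} := by
  obtain ⟨u, hu_anti, hu_pos, hu⟩ := exists_seq_strictAnti_tendsto (0 : ℝ)
  let S : ℕ → Set T := fun n => ⋃ m ≥ n, f m ⁻¹' Metric.thickening (u n) C
  have hS (n : ℕ) : MeasurableSet (S n) := .biUnion (to_countable _) fun m _ =>
    hf m Metric.isOpen_thickening.measurableSet
  have hanti : Antitone S := fun m n hmn => biUnion_mono (fun j hj => hmn.trans hj)
    fun j _ => preimage_mono (Metric.thickening_mono (hu_anti.antitone hmn) C)
  have hle (n : ℕ) : (ρ : Measure Y) C ≤ μ (S n) := by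
    refine (measure_mono (Metric.self_subset_thickening (hu_pos n) C)).trans ?_
    refine (ProbabilityMeasure.le_liminf_measure_open_of_tendsto hρ
      Metric.isOpen_thickening).trans ?_
    refine liminf_le_of_frequently_le' (Eventually.frequently ?_)
    filter_upwards [eventually_ge_atTop n] with m hm
    rw [hν m, Measure.map_apply (hf m) Metric.isOpen_thickening.measurableSet]
    exact measure_mono (subset_biUnion_of_mem (u := fun m => f m ⁻¹' Metric.thickening (u n) C) hm)
  have htendsto := tendsto_measure_iInter_atTop (μ := μ) (fun n => (hS n).nullMeasurableSet) hanti
    ⟨0, measure_ne_top _ _⟩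
  refine (ge_of_tendsto' htendsto hle).trans (measure_mono_ae ?_)
  filter_upwards [hlim] with t ht htS
  by_contra hne
  obtain ⟨r, hr, hdisj⟩ := (disjoint_iff_inter_eq_empty.2
    (not_nonempty_iff_eq_empty.1 hne)).exists_thickenings (hG t) hC.isClosed
  have hev := ht _ Metric.isOpen_thickening (Metric.self_subset_thickening hr (G t))
  obtain ⟨n, hn, hun⟩ := ((eventually_forall_ge_atTop.2 hev).and
    (hu.eventually (gt_mem_nhds hr))).exists
  obtain ⟨m, hm, hmem⟩ := mem_iUnion₂.1 (mem_iInter.1 htS n)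
  exact disjoint_left.1 hdisj (hn m hm) (Metric.thickening_mono hun.le C hmem)

/-- Lemma 5: upper semicontinuity of `x ↦ D_{F(·,x)}` into the space of probability
measures with the weak topology. -/
theorem stmt_10 {X T Y : Type*} [MetricSpace X] [MeasurableSpace T]
    [MetricSpace Y] [Countable Y] [CompleteSpace Y] [MeasurableSpace Y] [BorelSpace Y]
    (μ : Measure T) [IsProbabilityMeasure μ] (hatomless : AtomlessMeasure μ)
    (F : T → X → Set Y)
    (hne : ∀ t x, (F t x).Nonempty)
    (hcompact : ∀ t x, IsCompact (F t x))
    (hmeas : ∀ x : X, ∀ C : Set Y, IsClosed C →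
      MeasurableSet {t : T | (F t x ∩ C).Nonempty})
    (husc : ∀ t : T, UpperSemicontinuousCorr (F t))
    (H : T → Set Y) (hH : ∀ t, IsCompact (H t)) (hFH : ∀ t x, F t x ⊆ H t) :
    UpperSemicontinuousCorr (fun x : X =>
      {ν : ProbabilityMeasure Y | ∃ f : T → Y, Measurable f ∧
        (∀ᵐ t ∂μ, f t ∈ F t x) ∧ (ν : Measure Y) = μ.map f}) := by
  intro x V hV hxV
  by_contra! hcon
  have hchoose (n : ℕ) : ∃ y, dist y x < 1 / ((n : ℝ) + 1) ∧ ∃ ν : ProbabilityMeasure Y, ν ∉ V ∧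
      ∃ f : T → Y, Measurable f ∧ (∀ᵐ t ∂μ, f t ∈ F t y) ∧ (ν : Measure Y) = μ.map f := by
    obtain ⟨y, hy, hyV⟩ := hcon (Metric.ball x (1 / ((n : ℝ) + 1))) Metric.isOpen_ball
      (Metric.mem_ball_self Nat.one_div_pos_of_nat)
    obtain ⟨ν, hν, hνV⟩ := not_subset.1 hyV
    exact ⟨y, hy, ν, hνV, hν⟩
  choose y hy ν hνV f hf hfF hνf using hchoose
  have hyx : Tendsto y atTop (𝓝 x) :=
    tendsto_iff_dist_tendsto_zero.2 (squeeze_zero (fun _ => dist_nonneg) (fun n => (hy n).le)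
      tendsto_one_div_add_atTop_nhds_zero_nat)
  have hae : ∀ᵐ t ∂μ, ∀ n, f n t ∈ F t (y n) := ae_all_iff.2 hfF
  have htight : IsTightMeasureSet (range fun n => μ.map (f n)) :=
    isTightMeasureSet_range_map hf <| by
      filter_upwards [hae] with t ht using ⟨H t, hH t, fun n => hFH t (y n) (ht n)⟩
  have hcpt : IsCompact (closure (range ν)) := by
    refine isCompact_closure_of_isTightMeasureSet (htight.subset ?_)
    rintro _ ⟨_, ⟨n, rfl⟩, rfl⟩
    exact ⟨n, (hνf n).symm⟩
  obtain ⟨ρ, -, φ, hφ, hρ⟩ := hcpt.tendsto_subseq fun n => subset_closure (mem_range_self n)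
  have hlim : ∀ᵐ t ∂μ, ∀ W, IsOpen W → F t x ⊆ W → ∀ᶠ n in atTop, f (φ n) t ∈ W := by
    filter_upwards [hae] with t ht W hW hFW
    obtain ⟨U, hU, hxU, hUW⟩ := husc t x W hW hFW
    filter_upwards [(hyx.comp hφ.tendsto_atTop).eventually (hU.mem_nhds hxU)] with n hn
    exact hUW _ hn (ht _)
  have hsingleton (z : Y) : MeasurableSet {t | z ∈ F t x} := by
    simpa [inter_singleton_nonempty] using hmeas x {z} isClosed_singleton
  obtain ⟨g, hg, hgF, hgρ⟩ := hatomless.exists_measurable_selection_map_eq (ν := (ρ : Measure Y))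
    hsingleton fun I => by
      have hle := measure_le_of_tendsto_map (fun n => hf (φ n)) (fun n => hνf (φ n)) hρ
        (fun t => hcompact t x) hlim I.finite_toSet.isCompact
      refine hle.trans (measure_mono fun t ⟨z, hz, hzI⟩ => ?_)
      exact mem_biUnion hzI hz
  have hρV : ρ ∈ V := hxV ⟨g, hg, hgF, hgρ.symm⟩
  obtain ⟨n, hn⟩ := (hρ.eventually (hV.mem_nhds hρV)).exists
  exact hνV _ hn
end
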